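/- The Gauss curvatures of a patch and of its inverse patch satisfy K̃ = λ⁻²K + (4/r²)λ⁻¹ηH + (4/r⁴)η² at every point (u,v), where K = (eg − f²)/(EG − F²) and H = (eG − 2fF + gE)/(2(EG − F²)) are the Gauss and mean curvatures of x, and K̃ = (ẽg̃ − f̃²)/(ẼG̃ − F̃²) is the Gauss curvature of y. -/

import Mathlib

noncomputable section
open scoped RealInnerProductSpace

/-- ℝ³ as Euclidean 3-space. -/
abbrev E3 : Type := EuclideanSpace ℝ (Fin 3)

/-- The cross product on ℝ³. -/
def cross (a b : E3) : E3 :=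
  (WithLp.equiv 2 (Fin 3 → ℝ)).symm
    ![a 1 * b 2 - a 2 * b 1, a 2 * b 0 - a 0 * b 2, a 0 * b 1 - a 1 * b 0]

/-- The inversion of ℝ³ with center `c` and radius `r`. -/
def inv3 (c : E3) (r : ℝ) (p : E3) : E3 :=
  c + (r ^ 2 / ‖p - c‖ ^ 2) • (p - c)

/-- Partial derivative in the first variable. -/
def pu {E : Type*} [NormedAddCommGroup E] [NormedSpace ℝ E]
    (x : ℝ → ℝ → E) (u v : ℝ) : E :=
  deriv (fun t => x t v) u

/-- Partial derivative in the second variable. -/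
def pv {E : Type*} [NormedAddCommGroup E] [NormedSpace ℝ E]
    (x : ℝ → ℝ → E) (u v : ℝ) : E :=
  deriv (fun t => x u t) v

/-- The unit normal of a patch. -/
def unormal (x : ℝ → ℝ → E3) (u v : ℝ) : E3 :=
  ‖cross (pu x u v) (pv x u v)‖⁻¹ • cross (pu x u v) (pv x u v)

/-- The conformal factor λ of the inversion along the patch. -/
def lam (c : E3) (r : ℝ) (x : ℝ → ℝ → E3) (u v : ℝ) : ℝ :=
  r ^ 2 / ‖x u v - c‖ ^ 2

/-- The support-type function η = ⟨U_x, x − c⟩. -/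
def eta (c : E3) (x : ℝ → ℝ → E3) (u v : ℝ) : ℝ :=
  ⟪unormal x u v, x u v - c⟫

/-- First fundamental form coefficient E. -/
def FFE (x : ℝ → ℝ → E3) (u v : ℝ) : ℝ := ⟪pu x u v, pu x u v⟫
/-- First fundamental form coefficient F. -/
def FFF (x : ℝ → ℝ → E3) (u v : ℝ) : ℝ := ⟪pu x u v, pv x u v⟫
/-- First fundamental form coefficient G. -/
def FFG (x : ℝ → ℝ → E3) (u v : ℝ) : ℝ := ⟪pv x u v, pv x u v⟫
/-- Second fundamental form coefficient e. -/
def SFe (x : ℝ → ℝ → E3) (u v : ℝ) : ℝ := ⟪pu (pu x) u v, unormal x u v⟫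
/-- Second fundamental form coefficient f. -/
def SFf (x : ℝ → ℝ → E3) (u v : ℝ) : ℝ := ⟪pv (pu x) u v, unormal x u v⟫
/-- Second fundamental form coefficient g. -/
def SFg (x : ℝ → ℝ → E3) (u v : ℝ) : ℝ := ⟪pv (pv x) u v, unormal x u v⟫
/-- Third fundamental form coefficient P. -/
def TFP (x : ℝ → ℝ → E3) (u v : ℝ) : ℝ := ⟪pu (unormal x) u v, pu (unormal x) u v⟫
/-- Third fundamental form coefficient Q. -/
def TFQ (x : ℝ → ℝ → E3) (u v : ℝ) : ℝ := ⟪pu (unormal x) u v, pv (unormal x) u v⟫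
/-- Third fundamental form coefficient R. -/
def TFR (x : ℝ → ℝ → E3) (u v : ℝ) : ℝ := ⟪pv (unormal x) u v, pv (unormal x) u v⟫

/-- Christoffel symbol Γ¹₁₁. -/
def Ch111 (x : ℝ → ℝ → E3) (u v : ℝ) : ℝ :=
  (FFG x u v * pu (FFE x) u v - 2 * FFF x u v * pu (FFF x) u v + FFF x u v * pv (FFE x) u v) /
    (2 * (FFE x u v * FFG x u v - FFF x u v ^ 2))
/-- Christoffel symbol Γ²₁₁. -/
def Ch211 (x : ℝ → ℝ → E3) (u v : ℝ) : ℝ :=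
  (2 * FFE x u v * pu (FFF x) u v - FFE x u v * pv (FFE x) u v - FFF x u v * pu (FFE x) u v) /
    (2 * (FFE x u v * FFG x u v - FFF x u v ^ 2))
/-- Christoffel symbol Γ¹₁₂. -/
def Ch112 (x : ℝ → ℝ → E3) (u v : ℝ) : ℝ :=
  (FFG x u v * pv (FFE x) u v - FFF x u v * pu (FFG x) u v) /
    (2 * (FFE x u v * FFG x u v - FFF x u v ^ 2))
/-- Christoffel symbol Γ²₁₂. -/
def Ch212 (x : ℝ → ℝ → E3) (u v : ℝ) : ℝ :=
  (FFE x u v * pu (FFG x) u v - FFF x u v * pv (FFE x) u v) /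
    (2 * (FFE x u v * FFG x u v - FFF x u v ^ 2))
/-- Christoffel symbol Γ¹₂₂. -/
def Ch122 (x : ℝ → ℝ → E3) (u v : ℝ) : ℝ :=
  (2 * FFG x u v * pv (FFF x) u v - FFG x u v * pu (FFG x) u v - FFF x u v * pv (FFG x) u v) /
    (2 * (FFE x u v * FFG x u v - FFF x u v ^ 2))
/-- Christoffel symbol Γ²₂₂. -/
def Ch222 (x : ℝ → ℝ → E3) (u v : ℝ) : ℝ :=
  (FFE x u v * pv (FFG x) u v - 2 * FFF x u v * pv (FFF x) u v + FFF x u v * pu (FFG x) u v) /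
    (2 * (FFE x u v * FFG x u v - FFF x u v ^ 2))

/-- The tangent map of the inversion at `p`. -/
def phiStar (c : E3) (r : ℝ) (p : E3) (w : E3) : E3 :=
  (r ^ 2 / ‖p - c‖ ^ 2) • w - (2 * r ^ 2 * ⟪p - c, w⟫ / ‖p - c‖ ^ 4) • (p - c)

theorem inner_E3 (a b : E3) : ⟪a, b⟫ = a 0 * b 0 + a 1 * b 1 + a 2 * b 2 := by
  simp only [PiLp.inner_apply, Fin.sum_univ_three, RCLike.inner_apply, conj_trivial]
  ring

@[simp] theorem cross_zero (a b : E3) : cross a b 0 = a 1 * b 2 - a 2 * b 1 := rfl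

@[simp] theorem cross_one (a b : E3) : cross a b 1 = a 2 * b 0 - a 0 * b 2 := rfl

@[simp] theorem cross_two (a b : E3) : cross a b 2 = a 0 * b 1 - a 1 * b 0 := rfl

theorem inner_cross_left (a b : E3) : ⟪a, cross a b⟫ = 0 := by
  simp only [inner_E3, cross_zero, cross_one, cross_two]
  ring

theorem inner_cross_right (a b : E3) : ⟪b, cross a b⟫ = 0 := by
  simp only [inner_E3, cross_zero, cross_one, cross_two]
  ring

/-- Lagrange's identity. -/
theorem norm_cross_sq (a b : E3) : ‖cross a b‖ ^ 2 = ⟪a, a⟫ * ⟪b, b⟫ - ⟪a, b⟫ ^ 2 := by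
  rw [← real_inner_self_eq_norm_sq]
  simp only [inner_E3, cross_zero, cross_one, cross_two]
  ring

section Inversion

variable {c p : E3} {r : ℝ}

/-- The tangent map of an inversion is a multiple of a reflection, hence conformal. -/
theorem inner_phiStar (hp : p ≠ c) (a b : E3) :
    ⟪phiStar c r p a, phiStar c r p b⟫ = (r ^ 2 / ‖p - c‖ ^ 2) ^ 2 * ⟪a, b⟫ := by
  have hs : ‖p - c‖ ≠ 0 := norm_ne_zero_iff.2 (sub_ne_zero.2 hp)
  simp only [phiStar]
  generalize p - c = w at *
  simp only [inner_sub_left, inner_sub_right, real_inner_smul_left, real_inner_smul_right,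
    real_inner_self_eq_norm_sq, real_inner_comm w]
  field_simp
  ring

theorem cross_phiStar (hp : p ≠ c) (a b : E3) :
    cross (phiStar c r p a) (phiStar c r p b) =
      (-(r ^ 2 / ‖p - c‖ ^ 2)) • phiStar c r p (cross a b) := by
  have hs : ‖p - c‖ ^ 2 ≠ 0 := pow_ne_zero 2 (norm_ne_zero_iff.2 (sub_ne_zero.2 hp))
  have h4 : ‖p - c‖ ^ 4 = (‖p - c‖ ^ 2) ^ 2 := by ring
  simp only [phiStar, h4]
  generalize p - c = w at *
  have hn : ‖w‖ ^ 2 = w 0 * w 0 + w 1 * w 1 + w 2 * w 2 := by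
    rw [← real_inner_self_eq_norm_sq, inner_E3]
  generalize ‖w‖ ^ 2 = s at *
  ext i
  fin_cases i <;>
  · simp [inner_E3]
    field_simp
    subst hn
    ring

/-- The derivative of `phiStar` along a curve is again a value of `phiStar`. -/
theorem HasDerivAt.phiStar_comp {X A : ℝ → E3} {X' A' : E3} {t : ℝ} (hX : HasDerivAt X X' t)
    (hA : HasDerivAt A A' t) (ht : X t ≠ c) :
    HasDerivAt (fun s => phiStar c r (X s) (A s))
      (phiStar c r (X t) (A' - (2 / ‖X t - c‖ ^ 2) •
        (⟪X t - c, A t⟫ • X' + ⟪X t - c, X'⟫ • A t - ⟪A t, X'⟫ • (X t - c)))) t := by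
  have hs : ‖X t - c‖ ≠ 0 := norm_ne_zero_iff.2 (sub_ne_zero.2 ht)
  have hw : HasDerivAt (fun s => X s - c) X' t := hX.sub_const c
  have hn := hw.norm_sq
  have hl := (hasDerivAt_const t (r ^ 2)).fun_div hn (pow_ne_zero 2 hs)
  have hm := ((hw.inner ℝ hA).const_mul (2 * r ^ 2)).fun_div (hn.fun_pow 2)
    (pow_ne_zero 2 (pow_ne_zero 2 hs))
  have h := (hl.fun_smul hA).fun_sub (hm.fun_smul hw)
  have h4 (q : E3) : ‖q‖ ^ 4 = (‖q‖ ^ 2) ^ 2 := by ring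
  simp only [phiStar, h4]
  refine h.congr_deriv ?_
  generalize X t - c = w at *
  simp only [inner_sub_right, inner_add_right, real_inner_smul_right, real_inner_self_eq_norm_sq,
    real_inner_comm X' (A t)]
  match_scalars <;> field_simp <;> ring

theorem HasDerivAt.inv3_comp {X : ℝ → E3} {X' : E3} {t : ℝ} (hX : HasDerivAt X X' t)
    (ht : X t ≠ c) :
    HasDerivAt (fun s => inv3 c r (X s)) (phiStar c r (X t) X') t := by
  have hs : ‖X t - c‖ ≠ 0 := norm_ne_zero_iff.2 (sub_ne_zero.2 ht)
  have hw : HasDerivAt (fun s => X s - c) X' t := hX.sub_const c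
  have hl := (hasDerivAt_const t (r ^ 2)).fun_div hw.norm_sq (pow_ne_zero 2 hs)
  have h := (hl.fun_smul hw).const_add c
  unfold inv3
  refine h.congr_deriv ?_
  unfold phiStar
  match_scalars <;> field_simp <;> ring

/-- The second fundamental form of an inverted patch, up to normalization of the normals; `d` is
the second derivative of the patch in the directions of the first derivatives `a'`, `b'`. -/
theorem inner_phiStar_cross (hp : p ≠ c) {a b a' b' d : E3} (ha : ⟪a', cross a b⟫ = 0)
    (hb : ⟪b', cross a b⟫ = 0) :
    ⟪phiStar c r p (d - (2 / ‖p - c‖ ^ 2) •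
        (⟪p - c, a'⟫ • b' + ⟪p - c, b'⟫ • a' - ⟪a', b'⟫ • (p - c))),
      cross (phiStar c r p a) (phiStar c r p b)⟫ =
      -(r ^ 2 / ‖p - c‖ ^ 2) ^ 3 *
        (⟪d, cross a b⟫ + 2 / ‖p - c‖ ^ 2 * ⟪a', b'⟫ * ⟪cross a b, p - c⟫) := by
  rw [cross_phiStar hp, real_inner_smul_right, inner_phiStar hp]
  simp only [inner_sub_left, inner_add_left, real_inner_smul_left, ha, hb,
    real_inner_comm (cross a b) p, real_inner_comm (cross a b) c, inner_sub_right]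
  ring

end Inversion

theorem ContDiff.hasDerivAt_pu {E : Type*} [NormedAddCommGroup E] [NormedSpace ℝ E]
    {x : ℝ → ℝ → E} (hx : ContDiff ℝ 1 (fun p : ℝ × ℝ => x p.1 p.2)) (u v : ℝ) :
    HasDerivAt (fun t => x t v) (pu x u v) u := by
  have h : Differentiable ℝ (fun t => x t v) :=
    (hx.comp (contDiff_id.prodMk contDiff_const)).differentiable one_ne_zero
  exact (h u).hasDerivAt

theorem ContDiff.hasDerivAt_pv {E : Type*} [NormedAddCommGroup E] [NormedSpace ℝ E]
    {x : ℝ → ℝ → E} (hx : ContDiff ℝ 1 (fun p : ℝ × ℝ => x p.1 p.2)) (u v : ℝ) :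
    HasDerivAt (fun t => x u t) (pv x u v) v := by
  have h : Differentiable ℝ (fun t => x u t) :=
    (hx.comp (contDiff_const.prodMk contDiff_id)).differentiable one_ne_zero
  exact (h v).hasDerivAt

theorem ContDiff.contDiff_pu {E : Type*} [NormedAddCommGroup E] [NormedSpace ℝ E]
    {x : ℝ → ℝ → E} (hx : ContDiff ℝ 2 (fun p : ℝ × ℝ => x p.1 p.2)) :
    ContDiff ℝ 1 (fun p : ℝ × ℝ => pu x p.1 p.2) := by
  have h : ContDiff ℝ 1 (fun p : ℝ × ℝ => fderiv ℝ (fun p : ℝ × ℝ => x p.1 p.2) p (1, 0)) :=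
    (hx.fderiv_right (m := 1) (by norm_num)).clm_apply contDiff_const
  convert h using 2 with p
  have hd := (hx.differentiable two_ne_zero (p.1, p.2)).hasFDerivAt.comp_hasDerivAt p.1
    ((hasDerivAt_id p.1).prodMk (hasDerivAt_const p.1 p.2))
  exact hd.deriv

theorem ContDiff.contDiff_pv {E : Type*} [NormedAddCommGroup E] [NormedSpace ℝ E]
    {x : ℝ → ℝ → E} (hx : ContDiff ℝ 2 (fun p : ℝ × ℝ => x p.1 p.2)) :
    ContDiff ℝ 1 (fun p : ℝ × ℝ => pv x p.1 p.2) := by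
  have h : ContDiff ℝ 1 (fun p : ℝ × ℝ => fderiv ℝ (fun p : ℝ × ℝ => x p.1 p.2) p (0, 1)) :=
    (hx.fderiv_right (m := 1) (by norm_num)).clm_apply contDiff_const
  convert h using 2 with p
  have hd := (hx.differentiable two_ne_zero (p.1, p.2)).hasFDerivAt.comp_hasDerivAt p.2
    ((hasDerivAt_const p.2 p.1).prodMk (hasDerivAt_id p.2))
  exact hd.deriv

/-- The determinant of the second fundamental form in terms of the unnormalized normal. -/
theorem SFe_mul_SFg_sub_SFf_sq (x : ℝ → ℝ → E3) (u v : ℝ) :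
    SFe x u v * SFg x u v - SFf x u v ^ 2 =
      (⟪pu (pu x) u v, cross (pu x u v) (pv x u v)⟫ *
          ⟪pv (pv x) u v, cross (pu x u v) (pv x u v)⟫ -
        ⟪pv (pu x) u v, cross (pu x u v) (pv x u v)⟫ ^ 2) /
        ‖cross (pu x u v) (pv x u v)‖ ^ 2 := by
  simp only [SFe, SFf, SFg, unormal, real_inner_smul_right]
  ring

theorem inverse_patch_gauss_curvature
    (c : E3) (r : ℝ) (hr : 0 < r)
    (x : ℝ → ℝ → E3)
    (hx : ContDiff ℝ (⊤ : ℕ∞) (fun p : ℝ × ℝ => x p.1 p.2))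
    (hxc : ∀ u v : ℝ, x u v ≠ c)
    (y : ℝ → ℝ → E3) (hy : ∀ u v : ℝ, y u v = inv3 c r (x u v))
    (hreg : ∀ u v : ℝ, cross (pu x u v) (pv x u v) ≠ 0) :
    ∀ u v : ℝ,
      (SFe y u v * SFg y u v - SFf y u v ^ 2) / (FFE y u v * FFG y u v - FFF y u v ^ 2) =
        (lam c r x u v ^ 2)⁻¹ *
            ((SFe x u v * SFg x u v - SFf x u v ^ 2) /
              (FFE x u v * FFG x u v - FFF x u v ^ 2)) +
          (4 / r ^ 2) * (lam c r x u v)⁻¹ * eta c x u v *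
            ((SFe x u v * FFG x u v - 2 * SFf x u v * FFF x u v + SFg x u v * FFE x u v) /
              (2 * (FFE x u v * FFG x u v - FFF x u v ^ 2))) +
          (4 / r ^ 4) * eta c x u v ^ 2 := by
  intro u v
  have hx2 : ContDiff ℝ 2 (fun p : ℝ × ℝ => x p.1 p.2) := hx.of_le (WithTop.coe_le_coe.2 le_top)
  have hx1 : ContDiff ℝ 1 (fun p : ℝ × ℝ => x p.1 p.2) := hx2.of_le one_le_two
  obtain rfl : y = fun u v => inv3 c r (x u v) := by
    ext1 u; ext1 v; exact hy u v
  set y : ℝ → ℝ → E3 := fun u v => inv3 c r (x u v)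
  have hyu : pu y = fun u v => phiStar c r (x u v) (pu x u v) := by
    ext1 u; ext1 v; exact ((hx1.hasDerivAt_pu u v).inv3_comp (hxc u v)).deriv
  have hyv : pv y = fun u v => phiStar c r (x u v) (pv x u v) := by
    ext1 u; ext1 v; exact ((hx1.hasDerivAt_pv u v).inv3_comp (hxc u v)).deriv
  have hyuu := ((hx1.hasDerivAt_pu u v).phiStar_comp (r := r)
    (hx2.contDiff_pu.hasDerivAt_pu u v) (hxc u v)).deriv
  have hyuv := ((hx1.hasDerivAt_pv u v).phiStar_comp (r := r)
    (hx2.contDiff_pu.hasDerivAt_pv u v) (hxc u v)).deriv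
  have hyvv := ((hx1.hasDerivAt_pv u v).phiStar_comp (r := r)
    (hx2.contDiff_pv.hasDerivAt_pv u v) (hxc u v)).deriv
  have hleft := inner_cross_left (pu x u v) (pv x u v)
  have hright := inner_cross_right (pu x u v) (pv x u v)
  have he : ⟪pu (pu y) u v, cross (pu y u v) (pv y u v)⟫ =
      -(r ^ 2 / ‖x u v - c‖ ^ 2) ^ 3 * (⟪pu (pu x) u v, cross (pu x u v) (pv x u v)⟫ +
        2 / ‖x u v - c‖ ^ 2 * ⟪pu x u v, pu x u v⟫ *
          ⟪cross (pu x u v) (pv x u v), x u v - c⟫) := by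
    rw [hyu, hyv, pu, hyuu]
    exact inner_phiStar_cross (hxc u v) hleft hleft
  have hf : ⟪pv (pu y) u v, cross (pu y u v) (pv y u v)⟫ =
      -(r ^ 2 / ‖x u v - c‖ ^ 2) ^ 3 * (⟪pv (pu x) u v, cross (pu x u v) (pv x u v)⟫ +
        2 / ‖x u v - c‖ ^ 2 * ⟪pu x u v, pv x u v⟫ *
          ⟪cross (pu x u v) (pv x u v), x u v - c⟫) := by
    rw [hyu, hyv, pv, hyuv]
    exact inner_phiStar_cross (hxc u v) hleft hright
  have hg : ⟪pv (pv y) u v, cross (pu y u v) (pv y u v)⟫ =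
      -(r ^ 2 / ‖x u v - c‖ ^ 2) ^ 3 * (⟪pv (pv x) u v, cross (pu x u v) (pv x u v)⟫ +
        2 / ‖x u v - c‖ ^ 2 * ⟪pv x u v, pv x u v⟫ *
          ⟪cross (pu x u v) (pv x u v), x u v - c⟫) := by
    rw [hyu, hyv, pv, hyvv]
    exact inner_phiStar_cross (hxc u v) hright hright
  have hN : ‖cross (pu x u v) (pv x u v)‖ ≠ 0 := norm_ne_zero_iff.2 (hreg u v)
  have hs : ‖x u v - c‖ ≠ 0 := norm_ne_zero_iff.2 (sub_ne_zero.2 (hxc u v))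
  have hdet (z : ℝ → ℝ → E3) : FFE z u v * FFG z u v - FFF z u v ^ 2 =
      ‖cross (pu z u v) (pv z u v)‖ ^ 2 := (norm_cross_sq _ _).symm
  have hnorm : ‖cross (pu y u v) (pv y u v)‖ ^ 2 =
      (r ^ 2 / ‖x u v - c‖ ^ 2) ^ 4 * ‖cross (pu x u v) (pv x u v)‖ ^ 2 := by
    simp only [norm_cross_sq, hyu, hyv, inner_phiStar (hxc u v)]
    ring
  rw [hdet, hdet, SFe_mul_SFg_sub_SFf_sq, he, hf, hg, hnorm, SFe_mul_SFg_sub_SFf_sq]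
  simp only [SFe, SFf, SFg, FFE, FFF, FFG, eta, lam, unormal, real_inner_smul_left,
    real_inner_smul_right]
  field_simp
  linear_combination (-8 * ⟪cross (pu x u v) (pv x u v), x u v - c⟫ ^ 2) *
    norm_cross_sq (pu x u v) (pv x u v)
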